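/- Under the standing hypotheses in the context, if there are a faithful set of left integrals and a faithful set of right integrals, then the counit ε and the bijective anti-multiplicative antipode S : A → A (satisfying m((S ⊗ id)(Δ(a))) = (id ⊗ ε)((1 ⊗ a)·E) and m((id ⊗ S)(Δ(a))) = (ε ⊗ id)(E·(a ⊗ 1)) for all a ∈ A) can be chosen so that, in addition, for every left integral φ and all a, b ∈ A one has S((id ⊗ φ)(Δ(a)·(1 ⊗ b))) = (id ⊗ φ)((1 ⊗ a)·Δ(b)). -/

import Mathlib

open TensorProduct

/-- Slice map `id ⊗ ω` landing in the left tensor factor. -/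
noncomputable def sL {B C : Type} [AddCommGroup B] [Module ℂ B] [AddCommGroup C] [Module ℂ C]
    (ω : C →ₗ[ℂ] ℂ) : (B ⊗[ℂ] C) →ₗ[ℂ] B :=
  (TensorProduct.rid ℂ B).toLinearMap ∘ₗ LinearMap.lTensor B ω

/-- Slice map `ω ⊗ id` landing in the right tensor factor. -/
noncomputable def sR {B C : Type} [AddCommGroup B] [Module ℂ B] [AddCommGroup C] [Module ℂ C]
    (ω : B →ₗ[ℂ] ℂ) : (B ⊗[ℂ] C) →ₗ[ℂ] C :=
  (TensorProduct.lid ℂ C).toLinearMap ∘ₗ LinearMap.rTensor C ω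

/-- `u ⊗ v ↦ u ⊗ (v ⊗ 1)`, placing `A ⊗ A` in legs 1 and 2 of the triple tensor product. -/
noncomputable def leg12 (A : Type) [Ring A] [Algebra ℂ A] :
    (A ⊗[ℂ] A) →ₗ[ℂ] A ⊗[ℂ] (A ⊗[ℂ] A) :=
  TensorProduct.map LinearMap.id ((TensorProduct.mk ℂ A A).flip 1)

/-- `u ⊗ v ↦ u ⊗ (1 ⊗ v)`, placing `A ⊗ A` in legs 1 and 3 of the triple tensor product. -/
noncomputable def leg13 (A : Type) [Ring A] [Algebra ℂ A] :
    (A ⊗[ℂ] A) →ₗ[ℂ] A ⊗[ℂ] (A ⊗[ℂ] A) :=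
  TensorProduct.map LinearMap.id (TensorProduct.mk ℂ A A 1)

/-- A left integral: a nonzero functional with `(id ⊗ φ)(Δ a) ∈ C` for all `a`. -/
noncomputable def IsLeftIntegral (A : Type) [Ring A] [Algebra ℂ A] (Δ : A →ₗ[ℂ] A ⊗[ℂ] A)
    (C : Subalgebra ℂ A) (φ : A →ₗ[ℂ] ℂ) : Prop :=
  φ ≠ 0 ∧ ∀ a : A, sL φ (Δ a) ∈ C

/-- A right integral: a nonzero functional with `(ψ ⊗ id)(Δ a) ∈ B` for all `a`. -/
noncomputable def IsRightIntegral (A : Type) [Ring A] [Algebra ℂ A] (Δ : A →ₗ[ℂ] A ⊗[ℂ] A)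
    (B : Subalgebra ℂ A) (ψ : A →ₗ[ℂ] ℂ) : Prop :=
  ψ ≠ 0 ∧ ∀ a : A, sR ψ (Δ a) ∈ B

/-- There is a faithful set of left integrals. -/
noncomputable def FaithfulLeftIntegrals (A : Type) [Ring A] [Algebra ℂ A]
    (Δ : A →ₗ[ℂ] A ⊗[ℂ] A) (C : Subalgebra ℂ A) : Prop :=
  (∀ a : A, (∀ φ : A →ₗ[ℂ] ℂ, IsLeftIntegral A Δ C φ → ∀ b : A, φ (a * b) = 0) → a = 0) ∧
  (∀ a : A, (∀ φ : A →ₗ[ℂ] ℂ, IsLeftIntegral A Δ C φ → ∀ b : A, φ (b * a) = 0) → a = 0)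

/-- There is a faithful set of right integrals. -/
noncomputable def FaithfulRightIntegrals (A : Type) [Ring A] [Algebra ℂ A]
    (Δ : A →ₗ[ℂ] A ⊗[ℂ] A) (B : Subalgebra ℂ A) : Prop :=
  (∀ a : A, (∀ ψ : A →ₗ[ℂ] ℂ, IsRightIntegral A Δ B ψ → ∀ b : A, ψ (a * b) = 0) → a = 0) ∧
  (∀ a : A, (∀ ψ : A →ₗ[ℂ] ℂ, IsRightIntegral A Δ B ψ → ∀ b : A, ψ (b * a) = 0) → a = 0)

section Slices

variable {A : Type} [Ring A] [Algebra ℂ A]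

section Module

variable {M N M' N' : Type} [AddCommGroup M] [Module ℂ M] [AddCommGroup N] [Module ℂ N]
  [AddCommGroup M'] [Module ℂ M'] [AddCommGroup N'] [Module ℂ N']

@[simp]
theorem sL_tmul (ω : N →ₗ[ℂ] ℂ) (x : M) (y : N) : sL ω (x ⊗ₜ[ℂ] y) = ω y • x := by
  simp [sL]

@[simp]
theorem sR_tmul (ω : M →ₗ[ℂ] ℂ) (x : M) (y : N) : sR ω (x ⊗ₜ[ℂ] y) = ω x • y := by
  simp [sR]

theorem apply_sL (ω : N →ₗ[ℂ] ℂ) (η : M →ₗ[ℂ] ℂ) (t : M ⊗[ℂ] N) :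
    η (sL ω t) = ω (sR η t) := by
  induction t with
  | zero => simp
  | add x y hx hy => simp [hx, hy]
  | tmul x y => simp [mul_comm]

theorem map_sL (ω : N →ₗ[ℂ] ℂ) (f : M →ₗ[ℂ] M') (t : M ⊗[ℂ] N) :
    sL ω (LinearMap.rTensor N f t) = f (sL ω t) := by
  induction t with
  | zero => simp
  | add x y hx hy => simp [hx, hy]
  | tmul x y => simp

theorem map_sR (ω : M →ₗ[ℂ] ℂ) (f : N →ₗ[ℂ] N') (t : M ⊗[ℂ] N) :
    sR ω (LinearMap.lTensor M f t) = f (sR ω t) := by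
  induction t with
  | zero => simp
  | add x y hx hy => simp [hx, hy]
  | tmul x y => simp

theorem sL_lTensor (ω : N' →ₗ[ℂ] ℂ) (f : N →ₗ[ℂ] N') (t : M ⊗[ℂ] N) :
    sL ω (LinearMap.lTensor M f t) = sL (ω ∘ₗ f) t := by
  induction t with
  | zero => simp
  | add x y hx hy => simp [hx, hy]
  | tmul x y => simp

/-- Slices by functionals on the right factor separate the points of a tensor product. -/
theorem eq_zero_of_sL_eq_zero (t : M ⊗[ℂ] N) (h : ∀ ω : N →ₗ[ℂ] ℂ, sL ω t = 0) : t = 0 := by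
  classical
  let v := Module.Basis.ofVectorSpace ℂ N
  apply (TensorProduct.equivFinsuppOfBasisRight (M := M) v).injective
  ext i
  rw [map_zero, Finsupp.zero_apply, ← h (v.coord i)]
  clear h
  induction t with
  | zero => simp
  | add x y hx hy => simp [hx, hy]
  | tmul x y => simp

end Module

theorem sL_left_mul (ω : A →ₗ[ℂ] ℂ) (x : A) (t : A ⊗[ℂ] A) :
    sL ω ((x ⊗ₜ[ℂ] 1) * t) = x * sL ω t := by
  induction t with
  | zero => simp
  | add x y hx hy => simp [mul_add, hx, hy]
  | tmul x y => simp

theorem sL_mul_left (ω : A →ₗ[ℂ] ℂ) (x : A) (t : A ⊗[ℂ] A) :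
    sL ω (t * (x ⊗ₜ[ℂ] 1)) = sL ω t * x := by
  induction t with
  | zero => simp
  | add x y hx hy => simp [add_mul, hx, hy]
  | tmul x y => simp

theorem sR_right_mul (ω : A →ₗ[ℂ] ℂ) (x : A) (t : A ⊗[ℂ] A) :
    sR ω ((1 ⊗ₜ[ℂ] x) * t) = x * sR ω t := by
  induction t with
  | zero => simp
  | add x y hx hy => simp [mul_add, hx, hy]
  | tmul x y => simp

theorem sR_mul_right (ω : A →ₗ[ℂ] ℂ) (x : A) (t : A ⊗[ℂ] A) :
    sR ω (t * (1 ⊗ₜ[ℂ] x)) = sR ω t * x := by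
  induction t with
  | zero => simp
  | add x y hx hy => simp [add_mul, hx, hy]
  | tmul x y => simp

theorem sL_mul_right (ω : A →ₗ[ℂ] ℂ) (x : A) (t : A ⊗[ℂ] A) :
    sL ω (t * (1 ⊗ₜ[ℂ] x)) = sL (ω ∘ₗ LinearMap.mulRight ℂ x) t := by
  induction t with
  | zero => simp
  | add x y hx hy => simp [add_mul, hx, hy]
  | tmul x y => simp

theorem lTensor_sL_assoc_rTensor (Δ : A →ₗ[ℂ] A ⊗[ℂ] A) (ω : A →ₗ[ℂ] ℂ) (t : A ⊗[ℂ] A) :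
    LinearMap.lTensor A (sL ω) (TensorProduct.assoc ℂ A A A (LinearMap.rTensor A Δ t)) =
      Δ (sL ω t) := by
  induction t with
  | zero => simp
  | add x y hx hy => simp [hx, hy]
  | tmul x y =>
    simp only [LinearMap.rTensor_tmul, sL_tmul, map_smul]
    induction Δ x with
    | zero => simp
    | add u v hu hv => simp [TensorProduct.add_tmul, hu, hv]
    | tmul u v => simp

theorem sR_assoc_rTensor (Δ : A →ₗ[ℂ] A ⊗[ℂ] A) (ω : A →ₗ[ℂ] ℂ) (t : A ⊗[ℂ] A) :
    sR ω (TensorProduct.assoc ℂ A A A (LinearMap.rTensor A Δ t)) =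
      LinearMap.rTensor A (sR ω ∘ₗ Δ) t := by
  induction t with
  | zero => simp
  | add x y hx hy => simp [hx, hy]
  | tmul x y =>
    simp only [LinearMap.rTensor_tmul, LinearMap.comp_apply]
    induction Δ x with
    | zero => simp
    | add u v hu hv => simp [TensorProduct.add_tmul, hu, hv]
    | tmul u v => simp [TensorProduct.smul_tmul']

/-- The canonical map `x ⊗ y ↦ Δ x * (1 ⊗ y)`. -/
noncomputable def canonicalMap (Δ : A →ₗ[ℂ] A ⊗[ℂ] A) : A ⊗[ℂ] A →ₗ[ℂ] A ⊗[ℂ] A :=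
  TensorProduct.lift ((LinearMap.mul ℂ (A ⊗[ℂ] A)).compl₁₂ Δ (TensorProduct.mk ℂ A A 1))

@[simp]
theorem canonicalMap_tmul (Δ : A →ₗ[ℂ] A ⊗[ℂ] A) (x y : A) :
    canonicalMap Δ (x ⊗ₜ[ℂ] y) = Δ x * (1 ⊗ₜ[ℂ] y) := by
  simp [canonicalMap]

theorem canonicalMap_mul_right (Δ : A →ₗ[ℂ] A ⊗[ℂ] A) (q : A ⊗[ℂ] A) (y : A) :
    canonicalMap Δ (q * (1 ⊗ₜ[ℂ] y)) = canonicalMap Δ q * (1 ⊗ₜ[ℂ] y) := by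
  induction q with
  | zero => simp
  | add x y hx hy => simp [add_mul, hx, hy]
  | tmul u v => simp [mul_assoc]

/-- The map `x ⊗ y ↦ ∑ i, x * β i ⊗ b i * y`. -/
noncomputable def middleMul {ι : Type} [Fintype ι] (β b : ι → A) :
    A ⊗[ℂ] A →ₗ[ℂ] A ⊗[ℂ] A :=
  ∑ i, TensorProduct.map (LinearMap.mulRight ℂ (β i)) (LinearMap.mulLeft ℂ (b i))

@[simp]
theorem middleMul_tmul {ι : Type} [Fintype ι] (β b : ι → A) (x y : A) :
    middleMul β b (x ⊗ₜ[ℂ] y) = ∑ i, (x * β i) ⊗ₜ[ℂ] (b i * y) := by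
  simp [middleMul]

theorem middleMul_mul {ι : Type} [Fintype ι] (β b : ι → A) (x y : A) (q : A ⊗[ℂ] A) :
    middleMul β b ((x ⊗ₜ[ℂ] 1) * q * (1 ⊗ₜ[ℂ] y)) =
      (x ⊗ₜ[ℂ] 1) * middleMul β b q * (1 ⊗ₜ[ℂ] y) := by
  induction q with
  | zero => simp
  | add u v hu hv => simp [mul_add, add_mul, hu, hv]
  | tmul u v => simp [Finset.mul_sum, Finset.sum_mul, mul_assoc]

/-- The bilinear map sending `x ⊗ y` and `u ⊗ v` to `φ (y * v) • x ⊗ u`. -/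
noncomputable def pairRight (φ : A →ₗ[ℂ] ℂ) :
    A ⊗[ℂ] A →ₗ[ℂ] A ⊗[ℂ] A →ₗ[ℂ] A ⊗[ℂ] A :=
  (TensorProduct.map₂ (TensorProduct.mk ℂ A A) ((LinearMap.mul ℂ A).compr₂ φ)).compr₂
    (TensorProduct.rid ℂ (A ⊗[ℂ] A)).toLinearMap

@[simp]
theorem pairRight_tmul (φ : A →ₗ[ℂ] ℂ) (x y u v : A) :
    pairRight φ (x ⊗ₜ[ℂ] y) (u ⊗ₜ[ℂ] v) = φ (y * v) • (x ⊗ₜ[ℂ] u) := by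
  simp [pairRight]

theorem mul'_pairRight (φ : A →ₗ[ℂ] ℂ) (t u : A ⊗[ℂ] A) :
    LinearMap.mul' ℂ A (pairRight φ t u) = sL φ (t * u) := by
  induction t with
  | zero => simp
  | add x y hx hy => simp [add_mul, hx, hy]
  | tmul x y =>
    induction u with
    | zero => simp
    | add x y hx hy => simp [mul_add, hx, hy]
    | tmul u v => simp

theorem sR_pairRight (φ ω : A →ₗ[ℂ] ℂ) (t u : A ⊗[ℂ] A) :
    sR ω (pairRight φ t u) = sL φ ((1 ⊗ₜ[ℂ] sR ω t) * u) := by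
  induction t with
  | zero => simp
  | add x y hx hy => simp [TensorProduct.tmul_add, add_mul, hx, hy]
  | tmul x y =>
    induction u with
    | zero => simp
    | add x y hx hy => simp [mul_add, hx, hy]
    | tmul u v => simp [smul_smul, mul_comm]

theorem canonicalMap_pairRight (Δ : A →ₗ[ℂ] A ⊗[ℂ] A) (φ : A →ₗ[ℂ] ℂ) (t u : A ⊗[ℂ] A) :
    canonicalMap Δ (pairRight φ t u) = LinearMap.lTensor A (sL φ)
      (TensorProduct.assoc ℂ A A A (LinearMap.rTensor A Δ t) * (1 ⊗ₜ[ℂ] u)) := by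
  induction t with
  | zero => simp
  | add x y hx hy => simp [add_mul, hx, hy]
  | tmul x y =>
    induction u with
    | zero => simp
    | add x y hx hy => simp [TensorProduct.tmul_add, mul_add, hx, hy]
    | tmul u v =>
      simp only [pairRight_tmul, map_smul, canonicalMap_tmul, LinearMap.rTensor_tmul]
      induction Δ x with
      | zero => simp
      | add r s hr hs => simp [TensorProduct.add_tmul, add_mul, hr, hs]
      | tmul r s => simp

end Slices

/-- A multiplicative, coassociative and full `Δ` whose range projection `∑ i, b i ⊗ c i`
exchanges its legs with `β`, `γ`, `δ`, `η`, together with faithful sets of functionals whose left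
slices lie in `C` and whose right slices lie in `B`. The conditions come in pairs exchanged by
passing to the opposite algebra. -/
structure ComulData {A : Type} [Ring A] [Algebra ℂ A] (Δ : A →ₗ[ℂ] A ⊗[ℂ] A) (B C : Set A)
    {ι : Type} [Fintype ι] (b c β γ δ η : ι → A) : Prop where
  comul_mul : ∀ x y : A, Δ (x * y) = Δ x * Δ y
  coassoc : ∀ a : A,
    TensorProduct.assoc ℂ A A A (LinearMap.rTensor A Δ (Δ a)) = LinearMap.lTensor A Δ (Δ a)
  full_left : Submodule.span ℂ {x : A | ∃ ω : A →ₗ[ℂ] ℂ, ∃ a : A, x = sL ω (Δ a)} = ⊤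
  full_right : Submodule.span ℂ {x : A | ∃ ω : A →ₗ[ℂ] ℂ, ∃ a : A, x = sR ω (Δ a)} = ⊤
  idem_mul : ∀ a : A, (∑ i, b i ⊗ₜ[ℂ] c i) * Δ a = Δ a
  mul_idem : ∀ a : A, Δ a * (∑ i, b i ⊗ₜ[ℂ] c i) = Δ a
  comul_left : ∀ k ∈ C, Δ k = (∑ i, b i ⊗ₜ[ℂ] c i) * (k ⊗ₜ[ℂ] 1)
  comul_left' : ∀ k ∈ C, Δ k = (k ⊗ₜ[ℂ] 1) * ∑ i, b i ⊗ₜ[ℂ] c i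
  comul_right : ∀ k ∈ B, Δ k = (1 ⊗ₜ[ℂ] k) * ∑ i, b i ⊗ₜ[ℂ] c i
  comul_right' : ∀ k ∈ B, Δ k = (∑ i, b i ⊗ₜ[ℂ] c i) * (1 ⊗ₜ[ℂ] k)
  swap_left : ∀ i a, (b i ⊗ₜ[ℂ] 1) * Δ a = (1 ⊗ₜ[ℂ] γ i) * Δ a
  swap_left' : ∀ i a, Δ a * (b i ⊗ₜ[ℂ] 1) = Δ a * (1 ⊗ₜ[ℂ] η i)
  swap_right : ∀ i a, Δ a * (1 ⊗ₜ[ℂ] c i) = Δ a * (β i ⊗ₜ[ℂ] 1)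
  swap_right' : ∀ i a, (1 ⊗ₜ[ℂ] c i) * Δ a = (δ i ⊗ₜ[ℂ] 1) * Δ a
  left_faithful : ∀ a : A,
    (∀ φ : A →ₗ[ℂ] ℂ, (∀ x, sL φ (Δ x) ∈ C) → ∀ x, φ (a * x) = 0) → a = 0
  left_faithful' : ∀ a : A,
    (∀ φ : A →ₗ[ℂ] ℂ, (∀ x, sL φ (Δ x) ∈ C) → ∀ x, φ (x * a) = 0) → a = 0
  right_faithful : ∀ a : A,
    (∀ ψ : A →ₗ[ℂ] ℂ, (∀ x, sR ψ (Δ x) ∈ B) → ∀ x, ψ (x * a) = 0) → a = 0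
  right_faithful' : ∀ a : A,
    (∀ ψ : A →ₗ[ℂ] ℂ, (∀ x, sR ψ (Δ x) ∈ B) → ∀ x, ψ (a * x) = 0) → a = 0

namespace ComulData

variable {A : Type} [Ring A] [Algebra ℂ A] {Δ : A →ₗ[ℂ] A ⊗[ℂ] A} {B C : Set A}
  {ι : Type} [Fintype ι] {b c β γ δ η : ι → A}

theorem ext_lTensor (D : ComulData Δ B C b c β γ δ η) {f g : A →ₗ[ℂ] A}
    (h : ∀ a, LinearMap.lTensor A f (Δ a) = LinearMap.lTensor A g (Δ a)) : f = g := by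
  refine LinearMap.ext_on D.full_right ?_
  rintro _ ⟨ω, a, rfl⟩
  rw [← map_sR, ← map_sR, h]

theorem ext_rTensor (D : ComulData Δ B C b c β γ δ η) {f g : A →ₗ[ℂ] A}
    (h : ∀ a, LinearMap.rTensor A f (Δ a) = LinearMap.rTensor A g (Δ a)) : f = g := by
  refine LinearMap.ext_on D.full_left ?_
  rintro _ ⟨ω, a, rfl⟩
  rw [← map_sL, ← map_sL, h]

theorem sL_comul_eq_sum (D : ComulData Δ B C b c β γ δ η) {φ : A →ₗ[ℂ] ℂ}
    (hφ : ∀ x, sL φ (Δ x) ∈ C) (y : A) : sL φ (Δ y) = ∑ i, φ (γ i * y) • c i := by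
  have key : sL φ ∘ₗ Δ = ∑ i, (φ ∘ₗ LinearMap.mulLeft ℂ (γ i)).smulRight (c i) := by
    refine D.ext_lTensor fun a => ?_
    have h1 : LinearMap.lTensor A (sL φ ∘ₗ Δ) (Δ a) = Δ (sL φ (Δ a)) := by
      rw [LinearMap.lTensor_comp, LinearMap.comp_apply, ← D.coassoc, lTensor_sL_assoc_rTensor]
    have h2 : ∀ (i : ι) (t : A ⊗[ℂ] A), LinearMap.lTensor A
        ((φ ∘ₗ LinearMap.mulLeft ℂ (γ i)).smulRight (c i)) t =
          sL φ ((1 ⊗ₜ[ℂ] γ i) * t) ⊗ₜ[ℂ] c i := by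
      intro i t
      induction t with
      | zero => simp
      | add x y hx hy => simp [mul_add, TensorProduct.add_tmul, hx, hy]
      | tmul x y => simp [TensorProduct.smul_tmul']
    rw [h1, D.comul_left _ (hφ a), ← LinearMap.coe_lTensorHom, map_sum,
      LinearMap.sum_apply, Finset.sum_mul]
    refine Finset.sum_congr rfl fun i _ => ?_
    rw [LinearMap.coe_lTensorHom, h2, ← D.swap_left, sL_left_mul]
    simp
  simpa using LinearMap.congr_fun key y

theorem sR_comul_eq_sum (D : ComulData Δ B C b c β γ δ η) {ψ : A →ₗ[ℂ] ℂ}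
    (hψ : ∀ x, sR ψ (Δ x) ∈ B) (y : A) : sR ψ (Δ y) = ∑ i, ψ (y * β i) • b i := by
  have key : sR ψ ∘ₗ Δ = ∑ i, (ψ ∘ₗ LinearMap.mulRight ℂ (β i)).smulRight (b i) := by
    refine D.ext_rTensor fun a => ?_
    have h1 : LinearMap.rTensor A (sR ψ ∘ₗ Δ) (Δ a) = Δ (sR ψ (Δ a)) := by
      rw [← sR_assoc_rTensor, D.coassoc, map_sR]
    have h2 : ∀ (i : ι) (t : A ⊗[ℂ] A), LinearMap.rTensor A
        ((ψ ∘ₗ LinearMap.mulRight ℂ (β i)).smulRight (b i)) t =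
          b i ⊗ₜ[ℂ] sR ψ (t * (β i ⊗ₜ[ℂ] 1)) := by
      intro i t
      induction t with
      | zero => simp
      | add x y hx hy => simp [add_mul, TensorProduct.tmul_add, hx, hy]
      | tmul x y => simp [TensorProduct.smul_tmul]
    rw [h1, D.comul_right _ (hψ a), ← LinearMap.coe_rTensorHom, map_sum,
      LinearMap.sum_apply, Finset.mul_sum]
    refine Finset.sum_congr rfl fun i _ => ?_
    rw [LinearMap.coe_rTensorHom, h2, ← D.swap_right, sR_mul_right]
    simp
  simpa using LinearMap.congr_fun key y

theorem sR_comul_mul_canonicalMap (D : ComulData Δ B C b c β γ δ η) {ψ : A →ₗ[ℂ] ℂ}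
    (hψ : ∀ x, sR ψ (Δ x) ∈ B) (x : A) (q : A ⊗[ℂ] A) :
    sR ψ (Δ x * canonicalMap Δ q) = sR (ψ ∘ₗ LinearMap.mulLeft ℂ x) (middleMul β b q) := by
  induction q with
  | zero => simp
  | add u v hu hv => simp [mul_add, hu, hv]
  | tmul u v =>
    rw [canonicalMap_tmul, ← mul_assoc, ← D.comul_mul, sR_mul_right, D.sR_comul_eq_sum hψ]
    simp [Finset.sum_mul, mul_assoc]

theorem ker_canonicalMap_le (D : ComulData Δ B C b c β γ δ η) :
    LinearMap.ker (canonicalMap Δ) ≤ LinearMap.ker (middleMul β b) := by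
  intro q hq
  rw [LinearMap.mem_ker] at hq ⊢
  refine eq_zero_of_sL_eq_zero _ fun ω => D.right_faithful _ fun ψ hψ x => ?_
  have := apply_sL ω (ψ ∘ₗ LinearMap.mulLeft ℂ x) (middleMul β b q)
  rw [← D.sR_comul_mul_canonicalMap hψ, hq] at this
  simpa using this

theorem exists_canonicalMap_lift (D : ComulData Δ B C b c β γ δ η) :
    ∃ L : A ⊗[ℂ] A →ₗ[ℂ] A ⊗[ℂ] A, ∀ q, L (canonicalMap Δ q) = middleMul β b q := by
  obtain ⟨L, hL⟩ := LinearMap.exists_extend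
    ((LinearMap.ker (canonicalMap Δ)).liftQ (middleMul β b) D.ker_canonicalMap_le ∘ₗ
      (canonicalMap Δ).quotKerEquivRange.symm.toLinearMap)
  refine ⟨L, fun q => ?_⟩
  have := LinearMap.congr_fun hL ⟨canonicalMap Δ q, LinearMap.mem_range_self _ q⟩
  simpa [LinearMap.quotKerEquivRange_symm_apply_image] using this

theorem canonicalMap_pairRight_comul (D : ComulData Δ B C b c β γ δ η) {φ : A →ₗ[ℂ] ℂ}
    (hφ : ∀ x, sL φ (Δ x) ∈ C) (x y : A) :
    canonicalMap Δ (pairRight φ (Δ x) (Δ y)) =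
      (∑ i, b i ⊗ₜ[ℂ] c i) * (sL φ (Δ x * (1 ⊗ₜ[ℂ] y)) ⊗ₜ[ℂ] 1) := by
  have h1 : ∀ t : A ⊗[ℂ] A, LinearMap.lTensor A (sL φ)
      (LinearMap.lTensor A Δ t * (1 ⊗ₜ[ℂ] Δ y)) =
        ∑ i, sL φ ((1 ⊗ₜ[ℂ] γ i) * (t * (1 ⊗ₜ[ℂ] y))) ⊗ₜ[ℂ] c i := by
    intro t
    induction t with
    | zero => simp
    | add u v hu hv =>
      simp [add_mul, mul_add, TensorProduct.add_tmul, Finset.sum_add_distrib, hu, hv]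
    | tmul u v =>
      simp [← D.comul_mul, D.sL_comul_eq_sum hφ, TensorProduct.tmul_sum, TensorProduct.smul_tmul']
  rw [canonicalMap_pairRight, D.coassoc, h1, Finset.sum_mul]
  refine Finset.sum_congr rfl fun i _ => ?_
  rw [← mul_assoc, ← D.swap_left, mul_assoc, sL_left_mul]
  simp

theorem middleMul_pairRight_comul (D : ComulData Δ B C b c β γ δ η) (φ : A →ₗ[ℂ] ℂ) (x y : A) :
    middleMul β b (pairRight φ (Δ x) (Δ y)) = pairRight φ (Δ x) (Δ y) := by
  have h1 : ∀ t u : A ⊗[ℂ] A, middleMul β b (pairRight φ t u) =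
      ∑ i, pairRight φ (t * (β i ⊗ₜ[ℂ] 1)) ((b i ⊗ₜ[ℂ] 1) * u) := by
    intro t u
    induction t with
    | zero => simp
    | add x y hx hy => simp [add_mul, Finset.sum_add_distrib, hx, hy]
    | tmul x y =>
      induction u with
      | zero => simp
      | add x y hx hy => simp [mul_add, Finset.sum_add_distrib, hx, hy]
      | tmul u v => simp [Finset.smul_sum]
  have h2 : ∀ (r s : A) (t u : A ⊗[ℂ] A),
      pairRight φ (t * (1 ⊗ₜ[ℂ] s)) ((r ⊗ₜ[ℂ] 1) * u) = pairRight φ t ((r ⊗ₜ[ℂ] s) * u) := by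
    intro r s t u
    induction t with
    | zero => simp
    | add x y hx hy => simp [add_mul, hx, hy]
    | tmul x y =>
      induction u with
      | zero => simp
      | add x y hx hy => simp only [mul_add, map_add, hx, hy]
      | tmul u v => simp [mul_assoc]
  simp_rw [h1, ← D.swap_right, h2]
  rw [← map_sum, ← Finset.sum_mul, D.idem_mul]

theorem exists_pairRight_lift (D : ComulData Δ B C b c β γ δ η) :
    ∃ R : A →ₗ[ℂ] A ⊗[ℂ] A, ∀ φ : A →ₗ[ℂ] ℂ, (∀ x, sL φ (Δ x) ∈ C) → ∀ x y : A,
      R (sL φ (Δ x * (1 ⊗ₜ[ℂ] y))) = pairRight φ (Δ x) (Δ y) := by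
  obtain ⟨L, hL⟩ := D.exists_canonicalMap_lift
  refine ⟨L ∘ₗ LinearMap.mulLeft ℂ (∑ i, b i ⊗ₜ[ℂ] c i) ∘ₗ (TensorProduct.mk ℂ A A).flip 1,
    fun φ hφ x y => ?_⟩
  simp only [LinearMap.comp_apply, LinearMap.flip_apply, TensorProduct.mk_apply,
    LinearMap.mulLeft_apply]
  rw [← D.canonicalMap_pairRight_comul hφ, hL, D.middleMul_pairRight_comul]

theorem exists_antipode (D : ComulData Δ B C b c β γ δ η) {ε : A →ₗ[ℂ] ℂ}
    (hε : ∀ a, sR ε (Δ a) = a) :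
    ∃ S : A →ₗ[ℂ] A, ∀ φ : A →ₗ[ℂ] ℂ, (∀ x, sL φ (Δ x) ∈ C) → ∀ x y : A,
      S (sL φ (Δ x * (1 ⊗ₜ[ℂ] y))) = sL φ ((1 ⊗ₜ[ℂ] x) * Δ y) := by
  obtain ⟨R, hR⟩ := D.exists_pairRight_lift
  refine ⟨sR ε ∘ₗ R, fun φ hφ x y => ?_⟩
  rw [LinearMap.comp_apply, hR φ hφ, sR_pairRight, hε]

theorem ext_slices (D : ComulData Δ B C b c β γ δ η) {N : Type*} [AddCommGroup N] [Module ℂ N]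
    {f g : A →ₗ[ℂ] N}
    (h : ∀ φ : A →ₗ[ℂ] ℂ, (∀ x, sL φ (Δ x) ∈ C) → ∀ x y : A,
      f (sL φ (Δ x * (1 ⊗ₜ[ℂ] y))) = g (sL φ (Δ x * (1 ⊗ₜ[ℂ] y)))) : f = g := by
  let W := Submodule.span ℂ {z : A | ∃ φ : A →ₗ[ℂ] ℂ, (∀ x, sL φ (Δ x) ∈ C) ∧
    ∃ x y : A, z = sL φ (Δ x * (1 ⊗ₜ[ℂ] y))}
  suffices hW : W = ⊤ by
    refine LinearMap.ext_on hW ?_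
    rintro _ ⟨φ, hφ, x, y, rfl⟩
    exact h φ hφ x y
  by_contra hW
  obtain ⟨ω, hω, hle⟩ := Submodule.exists_le_ker_of_lt_top W (lt_top_iff_ne_top.2 hW)
  refine hω (LinearMap.ext_on D.full_left ?_)
  rintro _ ⟨ω', a, rfl⟩
  suffices ha : sR ω (Δ a) = 0 by rw [apply_sL, ha]; simp
  refine D.left_faithful _ fun φ hφ x => ?_
  rw [← sR_mul_right, ← apply_sL]
  exact hle (Submodule.subset_span ⟨φ, hφ, a, x, rfl⟩)

end ComulData

section Opposite

variable {A : Type} [Ring A] [Algebra ℂ A]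

/-- The identification of `A ⊗ A` with `Aᵐᵒᵖ ⊗ Aᵐᵒᵖ`. -/
noncomputable def opTensor (A : Type) [Ring A] [Algebra ℂ A] :
    A ⊗[ℂ] A ≃ₗ[ℂ] Aᵐᵒᵖ ⊗[ℂ] Aᵐᵒᵖ :=
  TensorProduct.congr (MulOpposite.opLinearEquiv ℂ) (MulOpposite.opLinearEquiv ℂ)

@[simp]
theorem opTensor_tmul (x y : A) :
    opTensor A (x ⊗ₜ[ℂ] y) = MulOpposite.op x ⊗ₜ[ℂ] MulOpposite.op y := by
  simp [opTensor]

theorem opTensor_mul (t u : A ⊗[ℂ] A) :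
    opTensor A (t * u) = opTensor A u * opTensor A t := by
  induction t with
  | zero => simp
  | add x y hx hy => simp [add_mul, mul_add, hx, hy]
  | tmul x y =>
    induction u with
    | zero => simp
    | add u v hu hv => simp only [mul_add, map_add, add_mul, hu, hv]
    | tmul u v => simp

/-- The coproduct `Δ` viewed on the opposite algebra. -/
noncomputable def opComul (Δ : A →ₗ[ℂ] A ⊗[ℂ] A) : Aᵐᵒᵖ →ₗ[ℂ] Aᵐᵒᵖ ⊗[ℂ] Aᵐᵒᵖ :=
  (opTensor A).toLinearMap ∘ₗ Δ ∘ₗ (MulOpposite.opLinearEquiv ℂ).symm.toLinearMap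

@[simp]
theorem opComul_op (Δ : A →ₗ[ℂ] A ⊗[ℂ] A) (x : A) :
    opComul Δ (MulOpposite.op x) = opTensor A (Δ x) := by
  simp [opComul]

theorem sL_opTensor (ω : Aᵐᵒᵖ →ₗ[ℂ] ℂ) (t : A ⊗[ℂ] A) : sL ω (opTensor A t) =
    MulOpposite.op (sL (ω ∘ₗ (MulOpposite.opLinearEquiv ℂ).toLinearMap) t) := by
  induction t with
  | zero => simp
  | add x y hx hy => simp [hx, hy]
  | tmul x y => simp

theorem sR_opTensor (ω : Aᵐᵒᵖ →ₗ[ℂ] ℂ) (t : A ⊗[ℂ] A) : sR ω (opTensor A t) =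
    MulOpposite.op (sR (ω ∘ₗ (MulOpposite.opLinearEquiv ℂ).toLinearMap) t) := by
  induction t with
  | zero => simp
  | add x y hx hy => simp [hx, hy]
  | tmul x y => simp

/-- Transport of a functional to the opposite algebra. -/
noncomputable def opDual (ω : A →ₗ[ℂ] ℂ) : Aᵐᵒᵖ →ₗ[ℂ] ℂ :=
  ω ∘ₗ (MulOpposite.opLinearEquiv ℂ).symm.toLinearMap

@[simp]
theorem opDual_op (ω : A →ₗ[ℂ] ℂ) (x : A) : opDual ω (MulOpposite.op x) = ω x := by
  simp [opDual]

@[simp]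
theorem opDual_comp_op (ω : A →ₗ[ℂ] ℂ) :
    opDual ω ∘ₗ (MulOpposite.opLinearEquiv ℂ).toLinearMap = ω := by
  ext x
  simp

theorem opComul_coassoc {Δ : A →ₗ[ℂ] A ⊗[ℂ] A}
    (h : ∀ a : A,
      TensorProduct.assoc ℂ A A A (LinearMap.rTensor A Δ (Δ a)) = LinearMap.lTensor A Δ (Δ a))
    (a : Aᵐᵒᵖ) :
    TensorProduct.assoc ℂ Aᵐᵒᵖ Aᵐᵒᵖ Aᵐᵒᵖ
        (LinearMap.rTensor Aᵐᵒᵖ (opComul Δ) (opComul Δ a)) =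
      LinearMap.lTensor Aᵐᵒᵖ (opComul Δ) (opComul Δ a) := by
  let T := TensorProduct.map (MulOpposite.opLinearEquiv ℂ : A ≃ₗ[ℂ] Aᵐᵒᵖ).toLinearMap
    (opTensor A).toLinearMap
  have h1 : ∀ t : A ⊗[ℂ] A, TensorProduct.assoc ℂ Aᵐᵒᵖ Aᵐᵒᵖ Aᵐᵒᵖ
      (LinearMap.rTensor Aᵐᵒᵖ (opComul Δ) (opTensor A t)) =
        T (TensorProduct.assoc ℂ A A A (LinearMap.rTensor A Δ t)) := by
    intro t
    induction t with
    | zero => simp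
    | add x y hx hy => simp [hx, hy]
    | tmul x y =>
      simp only [opTensor_tmul, LinearMap.rTensor_tmul, opComul_op]
      induction Δ x with
      | zero => simp
      | add u v hu hv => simp [TensorProduct.add_tmul, hu, hv]
      | tmul u v => simp [T]
  have h2 : ∀ t : A ⊗[ℂ] A, LinearMap.lTensor Aᵐᵒᵖ (opComul Δ) (opTensor A t) =
      T (LinearMap.lTensor A Δ t) := by
    intro t
    induction t with
    | zero => simp
    | add x y hx hy => simp [hx, hy]
    | tmul x y => simp [T]
  obtain ⟨x, rfl⟩ := MulOpposite.op_surjective a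
  rw [opComul_op, h1, h2, h]

end Opposite

namespace ComulData

variable {A : Type} [Ring A] [Algebra ℂ A] {Δ : A →ₗ[ℂ] A ⊗[ℂ] A} {B C : Set A}
  {ι : Type} [Fintype ι] {b c β γ δ η : ι → A}

open MulOpposite in
theorem opposite (D : ComulData Δ B C b c β γ δ η) :
    ComulData (opComul Δ) (unop ⁻¹' B) (unop ⁻¹' C) (op ∘ b) (op ∘ c) (op ∘ δ) (op ∘ η)
      (op ∘ β) (op ∘ γ) := by
  have hE : ∑ i, (op ∘ b) i ⊗ₜ[ℂ] (op ∘ c) i = opTensor A (∑ i, b i ⊗ₜ[ℂ] c i) := by simp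
  have hl : ∀ φ : A →ₗ[ℂ] ℂ, (∀ x, sL φ (Δ x) ∈ C) →
      ∀ x, sL (opDual φ) (opComul Δ x) ∈ unop ⁻¹' C := by
    intro φ hφ x
    obtain ⟨x, rfl⟩ := op_surjective x
    simpa [sL_opTensor] using hφ x
  have hr : ∀ ψ : A →ₗ[ℂ] ℂ, (∀ x, sR ψ (Δ x) ∈ B) →
      ∀ x, sR (opDual ψ) (opComul Δ x) ∈ unop ⁻¹' B := by
    intro ψ hψ x
    obtain ⟨x, rfl⟩ := op_surjective x
    simpa [sR_opTensor] using hψ x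
  have hl1 : ∀ x : A, (op x) ⊗ₜ[ℂ] (1 : Aᵐᵒᵖ) = opTensor A (x ⊗ₜ[ℂ] 1) := by simp
  have hr1 : ∀ x : A, (1 : Aᵐᵒᵖ) ⊗ₜ[ℂ] (op x) = opTensor A (1 ⊗ₜ[ℂ] x) := by simp
  have hsurj : ∀ {p : Aᵐᵒᵖ → Prop}, (∀ x, p (op x)) → ∀ x, p x :=
    fun h x => op_unop x ▸ h x.unop
  constructor
  · refine hsurj fun x => hsurj fun y => ?_
    rw [← op_mul, opComul_op, opComul_op, opComul_op, D.comul_mul, opTensor_mul]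
  · exact opComul_coassoc D.coassoc
  · rw [← top_le_iff, ← LinearEquiv.range (opLinearEquiv ℂ : A ≃ₗ[ℂ] Aᵐᵒᵖ),
      ← Submodule.map_top, ← D.full_left, Submodule.map_span_le]
    rintro _ ⟨ω, a, rfl⟩
    exact Submodule.subset_span ⟨opDual ω, op a, by simp [sL_opTensor]⟩
  · rw [← top_le_iff, ← LinearEquiv.range (opLinearEquiv ℂ : A ≃ₗ[ℂ] Aᵐᵒᵖ),
      ← Submodule.map_top, ← D.full_right, Submodule.map_span_le]
    rintro _ ⟨ω, a, rfl⟩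
    exact Submodule.subset_span ⟨opDual ω, op a, by simp [sR_opTensor]⟩
  · refine hsurj fun x => ?_
    rw [hE, opComul_op, ← opTensor_mul, D.mul_idem]
  · refine hsurj fun x => ?_
    rw [hE, opComul_op, ← opTensor_mul, D.idem_mul]
  · refine hsurj fun x hx => ?_
    rw [hE, opComul_op, hl1, ← opTensor_mul, ← D.comul_left' x hx]
  · refine hsurj fun x hx => ?_
    rw [hE, opComul_op, hl1, ← opTensor_mul, ← D.comul_left x hx]
  · refine hsurj fun x hx => ?_
    rw [hE, opComul_op, hr1, ← opTensor_mul, ← D.comul_right' x hx]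
  · refine hsurj fun x hx => ?_
    rw [hE, opComul_op, hr1, ← opTensor_mul, ← D.comul_right x hx]
  · refine fun i => hsurj fun x => ?_
    rw [Function.comp_apply, Function.comp_apply, opComul_op, hl1, hr1, ← opTensor_mul,
      ← opTensor_mul, D.swap_left']
  · refine fun i => hsurj fun x => ?_
    rw [Function.comp_apply, Function.comp_apply, opComul_op, hl1, hr1, ← opTensor_mul,
      ← opTensor_mul, D.swap_left]
  · refine fun i => hsurj fun x => ?_
    rw [Function.comp_apply, Function.comp_apply, opComul_op, hl1, hr1, ← opTensor_mul,
      ← opTensor_mul, D.swap_right']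
  · refine fun i => hsurj fun x => ?_
    rw [Function.comp_apply, Function.comp_apply, opComul_op, hl1, hr1, ← opTensor_mul,
      ← opTensor_mul, D.swap_right]
  · refine hsurj fun a ha => ?_
    rw [D.left_faithful' a fun φ hφ x => by simpa [← op_mul] using ha _ (hl φ hφ) (op x), op_zero]
  · refine hsurj fun a ha => ?_
    rw [D.left_faithful a fun φ hφ x => by simpa [← op_mul] using ha _ (hl φ hφ) (op x), op_zero]
  · refine hsurj fun a ha => ?_
    rw [D.right_faithful' a fun φ hφ x => by simpa [← op_mul] using ha _ (hr φ hφ) (op x), op_zero]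
  · refine hsurj fun a ha => ?_
    rw [D.right_faithful a fun φ hφ x => by simpa [← op_mul] using ha _ (hr φ hφ) (op x), op_zero]

open MulOpposite in
theorem bijective_antipode (D : ComulData Δ B C b c β γ δ η) {ε : A →ₗ[ℂ] ℂ}
    (hε : ∀ a, sR ε (Δ a) = a) {S : A →ₗ[ℂ] A}
    (hS : ∀ φ : A →ₗ[ℂ] ℂ, (∀ x, sL φ (Δ x) ∈ C) → ∀ x y : A,
      S (sL φ (Δ x * (1 ⊗ₜ[ℂ] y))) = sL φ ((1 ⊗ₜ[ℂ] x) * Δ y)) :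
    Function.Bijective S := by
  let o : A ≃ₗ[ℂ] Aᵐᵒᵖ := opLinearEquiv ℂ
  have hε' : ∀ a, sR (opDual ε) (opComul Δ a) = a := by
    intro a
    obtain ⟨a, rfl⟩ := op_surjective a
    simp [sR_opTensor, hε]
  obtain ⟨T, hT⟩ := D.opposite.exists_antipode hε'
  have hl : ∀ φ : A →ₗ[ℂ] ℂ, (∀ x, sL φ (Δ x) ∈ C) →
      ∀ x, sL (opDual φ) (opComul Δ x) ∈ unop ⁻¹' C := by
    intro φ hφ x
    obtain ⟨x, rfl⟩ := op_surjective x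
    simpa [sL_opTensor] using hφ x
  have hr1 : ∀ x : A, (1 : Aᵐᵒᵖ) ⊗ₜ[ℂ] (op x) = opTensor A (1 ⊗ₜ[ℂ] x) := by simp
  have hTS : o.symm.toLinearMap ∘ₗ T ∘ₗ o.toLinearMap ∘ₗ S = LinearMap.id := by
    refine D.ext_slices fun φ hφ x y => ?_
    have := hT (opDual φ) (hl φ hφ) (op y) (op x)
    rw [opComul_op, opComul_op, hr1, hr1, ← opTensor_mul, ← opTensor_mul, sL_opTensor,
      sL_opTensor, opDual_comp_op] at this
    simp [hS φ hφ, o, this]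
  have hST : o.toLinearMap ∘ₗ S ∘ₗ o.symm.toLinearMap ∘ₗ T = LinearMap.id := by
    refine D.opposite.ext_slices fun φ hφ x y => ?_
    have hφ' : ∀ x, sL (φ ∘ₗ o.toLinearMap) (Δ x) ∈ C := by
      intro x
      simpa [sL_opTensor] using hφ (op x)
    rw [LinearMap.comp_apply, LinearMap.comp_apply, LinearMap.comp_apply, hT φ hφ]
    obtain ⟨x, rfl⟩ := op_surjective x
    obtain ⟨y, rfl⟩ := op_surjective y
    rw [opComul_op, opComul_op, hr1, hr1, ← opTensor_mul, ← opTensor_mul, sL_opTensor,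
      sL_opTensor]
    simpa [o] using hS _ hφ' y x
  refine ⟨Function.LeftInverse.injective (g := o.symm ∘ T ∘ o) (LinearMap.congr_fun hTS), ?_⟩
  intro x
  exact ⟨o.symm (T (o x)), o.injective (LinearMap.congr_fun hST (o x))⟩

end ComulData

section Counit

variable {A : Type} [Ring A] [Algebra ℂ A]

theorem sR_canonicalMap {Δ : A →ₗ[ℂ] A ⊗[ℂ] A} {ε : A →ₗ[ℂ] ℂ} (hε : ∀ a, sR ε (Δ a) = a)
    (q : A ⊗[ℂ] A) : sR ε (canonicalMap Δ q) = LinearMap.mul' ℂ A q := by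
  induction q with
  | zero => simp
  | add x y hx hy => simp [hx, hy]
  | tmul x y => simp [sR_mul_right, hε]

theorem sL_comul_mul_right {Δ : A →ₗ[ℂ] A ⊗[ℂ] A} {ε : A →ₗ[ℂ] ℂ}
    (hε : ∀ a, sR ε (Δ a) = a) (x y : A) : ε (sL ε (Δ x * (1 ⊗ₜ[ℂ] y))) = ε (x * y) := by
  rw [apply_sL, sR_mul_right, hε]

/-- The bilinear map sending `x ⊗ y` and `u ⊗ v` to `x * u ⊗ S v * S y`. -/
noncomputable def twistedMul (S : A →ₗ[ℂ] A) :
    A ⊗[ℂ] A →ₗ[ℂ] A ⊗[ℂ] A →ₗ[ℂ] A ⊗[ℂ] A :=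
  TensorProduct.map₂ (LinearMap.mul ℂ A) ((LinearMap.mul ℂ A).compl₁₂ S S).flip

@[simp]
theorem twistedMul_tmul (S : A →ₗ[ℂ] A) (x y u v : A) :
    twistedMul S (x ⊗ₜ[ℂ] y) (u ⊗ₜ[ℂ] v) = (x * u) ⊗ₜ[ℂ] (S v * S y) := by
  simp [twistedMul]

theorem twistedMul_tmul_left (S : A →ₗ[ℂ] A) (x y : A) (u : A ⊗[ℂ] A) :
    twistedMul S (x ⊗ₜ[ℂ] y) u =
      (x ⊗ₜ[ℂ] 1) * LinearMap.lTensor A S u * (1 ⊗ₜ[ℂ] S y) := by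
  induction u with
  | zero => simp
  | add x y hx hy => simp [mul_add, add_mul, hx, hy]
  | tmul u v => simp

theorem mul'_mul (x y : A) (t : A ⊗[ℂ] A) :
    LinearMap.mul' ℂ A ((x ⊗ₜ[ℂ] 1) * t * (1 ⊗ₜ[ℂ] y)) = x * LinearMap.mul' ℂ A t * y := by
  induction t with
  | zero => simp
  | add u v hu hv => simp [mul_add, add_mul, hu, hv]
  | tmul u v => simp [mul_assoc]

end Counit

namespace ComulData

variable {A : Type} [Ring A] [Algebra ℂ A] {Δ : A →ₗ[ℂ] A ⊗[ℂ] A} {B C : Set A}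
  {ι : Type} [Fintype ι] {b c β γ δ η : ι → A}

theorem comul_sL (D : ComulData Δ B C b c β γ δ η) (ω : A →ₗ[ℂ] ℂ) (x : A) :
    Δ (sL ω (Δ x)) = LinearMap.lTensor A (sL ω ∘ₗ Δ) (Δ x) := by
  rw [LinearMap.lTensor_comp, LinearMap.comp_apply, ← D.coassoc, lTensor_sL_assoc_rTensor]

theorem exists_counit (D : ComulData Δ B C b c β γ δ η) {e : A →ₗ[ℂ] ℂ}
    (he : ∑ i, e (c i) • γ i = 1) :
    ∃ ε : A →ₗ[ℂ] ℂ, (∀ a, sR ε (Δ a) = a) ∧ (∀ a, sL ε (Δ a) = a) := by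
  obtain ⟨ε, hε⟩ : ∃ ε : A →ₗ[ℂ] ℂ, ∀ φ : A →ₗ[ℂ] ℂ, (∀ x, sL φ (Δ x) ∈ C) →
      ∀ x y : A, ε (sL φ (Δ x * (1 ⊗ₜ[ℂ] y))) = φ (x * y) := by
    obtain ⟨R, hR⟩ := D.exists_pairRight_lift
    refine ⟨e ∘ₗ LinearMap.mul' ℂ A ∘ₗ R, fun φ hφ x y => ?_⟩
    rw [LinearMap.comp_apply, LinearMap.comp_apply, hR φ hφ, mul'_pairRight, ← D.comul_mul,
      D.sL_comul_eq_sum hφ]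
    conv_rhs => rw [← one_mul (x * y), ← he, Finset.sum_mul, map_sum]
    simp [mul_comm]
  refine ⟨ε, fun a => ?_, LinearMap.congr_fun (f := sL ε ∘ₗ Δ) (g := LinearMap.id)
    (D.ext_slices fun φ hφ x y => ?_)⟩
  · rw [← sub_eq_zero]
    refine D.left_faithful _ fun φ hφ x => ?_
    rw [sub_mul, map_sub, ← hε φ hφ a x, ← sR_mul_right, apply_sL, sub_self]
  · have h : ε ∘ₗ sL (φ ∘ₗ LinearMap.mulRight ℂ y) ∘ₗ Δ = φ ∘ₗ LinearMap.mulRight ℂ y := by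
      ext z
      simpa [← sL_mul_right] using hε φ hφ z y
    rw [sL_mul_right, LinearMap.comp_apply, D.comul_sL, sL_lTensor, h, LinearMap.id_apply]

end ComulData

section Antipode

variable {A : Type} [Ring A] [Algebra ℂ A]

theorem lTensor_sL_eq_pairRight (φ : A →ₗ[ℂ] ℂ) (t u : A ⊗[ℂ] A) :
    LinearMap.lTensor A (sL φ ∘ₗ LinearMap.mulRight ℂ u ∘ₗ TensorProduct.mk ℂ A A 1) t =
      pairRight φ t u := by
  induction t with
  | zero => simp
  | add x y hx hy => simp [hx, hy]
  | tmul x y =>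
    induction u with
    | zero => simp
    | add u v hu hv =>
      simp only [LinearMap.lTensor_tmul, LinearMap.comp_apply, LinearMap.mulRight_apply,
        TensorProduct.mk_apply] at hu hv
      simp [mul_add, TensorProduct.tmul_add, hu, hv]
    | tmul u v => simp

theorem mul'_twistedMul (S : A →ₗ[ℂ] A) (t u : A ⊗[ℂ] A) :
    LinearMap.mul' ℂ A (twistedMul S t u) = LinearMap.mul' ℂ A
      (LinearMap.lTensor A S (t * (LinearMap.mul' ℂ A (LinearMap.lTensor A S u) ⊗ₜ[ℂ] 1))) := by
  induction t with
  | zero => simp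
  | add x y hx hy => simp [add_mul, hx, hy]
  | tmul x y =>
    rw [twistedMul_tmul_left, mul'_mul]
    simp

end Antipode

namespace ComulData

variable {A : Type} [Ring A] [Algebra ℂ A] {Δ : A →ₗ[ℂ] A ⊗[ℂ] A} {B C : Set A}
  {ι : Type} [Fintype ι] {b c β γ δ η : ι → A}

theorem comul_mul_of_mem (D : ComulData Δ B C b c β γ δ η) (x : A) {k : A} (hk : k ∈ C) :
    Δ (x * k) = Δ x * (k ⊗ₜ[ℂ] 1) := by
  rw [D.comul_mul, D.comul_left k hk, ← mul_assoc, D.mul_idem]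

theorem canonicalMap_left_mul (D : ComulData Δ B C b c β γ δ η) (x : A) (q : A ⊗[ℂ] A) :
    canonicalMap Δ ((x ⊗ₜ[ℂ] 1) * q) = Δ x * canonicalMap Δ q := by
  induction q with
  | zero => simp
  | add u v hu hv => simp [mul_add, hu, hv]
  | tmul u v => simp [D.comul_mul, mul_assoc]

theorem lTensor_antipode_comul_sL (D : ComulData Δ B C b c β γ δ η) {S : A →ₗ[ℂ] A}
    (hS : ∀ φ : A →ₗ[ℂ] ℂ, (∀ x, sL φ (Δ x) ∈ C) → ∀ x y : A,
      S (sL φ (Δ x * (1 ⊗ₜ[ℂ] y))) = sL φ ((1 ⊗ₜ[ℂ] x) * Δ y))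
    {φ : A →ₗ[ℂ] ℂ} (hφ : ∀ x, sL φ (Δ x) ∈ C) (x y : A) :
    LinearMap.lTensor A S (Δ (sL φ (Δ x * (1 ⊗ₜ[ℂ] y)))) = pairRight φ (Δ x) (Δ y) := by
  rw [sL_mul_right, D.comul_sL, ← LinearMap.comp_apply, ← LinearMap.lTensor_comp,
    ← lTensor_sL_eq_pairRight]
  congr 2
  ext z
  simpa [← sL_mul_right] using hS φ hφ z y

theorem canonicalMap_lTensor_antipode (D : ComulData Δ B C b c β γ δ η) {S : A →ₗ[ℂ] A}
    (hS : ∀ φ : A →ₗ[ℂ] ℂ, (∀ x, sL φ (Δ x) ∈ C) → ∀ x y : A,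
      S (sL φ (Δ x * (1 ⊗ₜ[ℂ] y))) = sL φ ((1 ⊗ₜ[ℂ] x) * Δ y)) (x : A) :
    canonicalMap Δ (LinearMap.lTensor A S (Δ x)) = (∑ i, b i ⊗ₜ[ℂ] c i) * (x ⊗ₜ[ℂ] 1) :=
  LinearMap.congr_fun (f := canonicalMap Δ ∘ₗ LinearMap.lTensor A S ∘ₗ Δ)
    (g := LinearMap.mulLeft ℂ (∑ i, b i ⊗ₜ[ℂ] c i) ∘ₗ (TensorProduct.mk ℂ A A).flip 1)
    (D.ext_slices fun φ hφ x y => by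
      rw [LinearMap.comp_apply, LinearMap.comp_apply, D.lTensor_antipode_comul_sL hS hφ,
        D.canonicalMap_pairRight_comul hφ]
      rfl) x

theorem middleMul_lTensor_antipode (D : ComulData Δ B C b c β γ δ η) {S : A →ₗ[ℂ] A}
    (hS : ∀ φ : A →ₗ[ℂ] ℂ, (∀ x, sL φ (Δ x) ∈ C) → ∀ x y : A,
      S (sL φ (Δ x * (1 ⊗ₜ[ℂ] y))) = sL φ ((1 ⊗ₜ[ℂ] x) * Δ y)) (x : A) :
    middleMul β b (LinearMap.lTensor A S (Δ x)) = LinearMap.lTensor A S (Δ x) :=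
  LinearMap.congr_fun (f := middleMul β b ∘ₗ LinearMap.lTensor A S ∘ₗ Δ)
    (g := LinearMap.lTensor A S ∘ₗ Δ)
    (D.ext_slices fun φ hφ x y => by
      rw [LinearMap.comp_apply, LinearMap.comp_apply, D.lTensor_antipode_comul_sL hS hφ,
        D.middleMul_pairRight_comul]) x

theorem mul'_lTensor_antipode (D : ComulData Δ B C b c β γ δ η) {S : A →ₗ[ℂ] A}
    (hS : ∀ φ : A →ₗ[ℂ] ℂ, (∀ x, sL φ (Δ x) ∈ C) → ∀ x y : A,
      S (sL φ (Δ x * (1 ⊗ₜ[ℂ] y))) = sL φ ((1 ⊗ₜ[ℂ] x) * Δ y))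
    {ε : A →ₗ[ℂ] ℂ} (hε : ∀ a, sR ε (Δ a) = a) (x : A) :
    LinearMap.mul' ℂ A (LinearMap.lTensor A S (Δ x)) =
      sR ε ((∑ i, b i ⊗ₜ[ℂ] c i) * (x ⊗ₜ[ℂ] 1)) := by
  rw [← D.canonicalMap_lTensor_antipode hS, sR_canonicalMap hε]

theorem mul'_rTensor_antipode (D : ComulData Δ B C b c β γ δ η) {S : A →ₗ[ℂ] A}
    (hS : ∀ φ : A →ₗ[ℂ] ℂ, (∀ x, sL φ (Δ x) ∈ C) → ∀ x y : A,
      S (sL φ (Δ x * (1 ⊗ₜ[ℂ] y))) = sL φ ((1 ⊗ₜ[ℂ] x) * Δ y))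
    {ε : A →ₗ[ℂ] ℂ} (hε : ∀ a, sR ε (Δ a) = a) (hε' : ∀ a, sL ε (Δ a) = a) (x : A) :
    LinearMap.mul' ℂ A (LinearMap.rTensor A S (Δ x)) =
      sL ε ((1 ⊗ₜ[ℂ] x) * ∑ i, b i ⊗ₜ[ℂ] c i) := by
  obtain ⟨L, hL⟩ := D.exists_canonicalMap_lift
  have h1 : ∀ t : A ⊗[ℂ] A, sR ε (L ((∑ i, b i ⊗ₜ[ℂ] c i) * t)) =
      LinearMap.mul' ℂ A (LinearMap.rTensor A S t) := by
    intro t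
    induction t with
    | zero => simp
    | add u v hu hv => simp only [mul_add, map_add, hu, hv]
    | tmul u v =>
      have huv : u ⊗ₜ[ℂ] v = (u ⊗ₜ[ℂ] 1) * ((1 : A) ⊗ₜ[ℂ] v) := by simp
      have hmid := middleMul_mul β b 1 v (LinearMap.lTensor A S (Δ u))
      rw [← Algebra.TensorProduct.one_def, one_mul, one_mul,
        D.middleMul_lTensor_antipode hS] at hmid
      rw [huv, ← mul_assoc, ← D.canonicalMap_lTensor_antipode hS, ← canonicalMap_mul_right, hL,
        hmid, sR_mul_right, map_sR, hε]
      simp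
  have h2 : ∀ i, ε (x * β i) = ε (x * c i) := by
    intro i
    rw [← sL_comul_mul_right hε x (c i), D.swap_right, sL_mul_left, hε']
  have h3 : Δ x = canonicalMap Δ (x ⊗ₜ[ℂ] 1) := by
    rw [canonicalMap_tmul, ← Algebra.TensorProduct.one_def, mul_one]
  rw [← h1, D.idem_mul, h3, hL]
  simp [Finset.mul_sum, h2]

theorem antipode_mul_of_mem (D : ComulData Δ B C b c β γ δ η) {S : A →ₗ[ℂ] A}
    (hS : ∀ φ : A →ₗ[ℂ] ℂ, (∀ x, sL φ (Δ x) ∈ C) → ∀ x y : A,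
      S (sL φ (Δ x * (1 ⊗ₜ[ℂ] y))) = sL φ ((1 ⊗ₜ[ℂ] x) * Δ y)) (x : A) {i : ι} (hi : c i ∈ C) :
    S (x * c i) = δ i * S x := by
  refine LinearMap.congr_fun (f := S ∘ₗ LinearMap.mulRight ℂ (c i))
    (g := LinearMap.mulLeft ℂ (δ i) ∘ₗ S) (D.ext_slices fun φ hφ x y => ?_) x
  have hcomm : (1 ⊗ₜ[ℂ] y) * (c i ⊗ₜ[ℂ] 1) = (c i ⊗ₜ[ℂ] 1) * ((1 : A) ⊗ₜ[ℂ] y) := by simp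
  have hx : (1 : A) ⊗ₜ[ℂ] (x * c i) = (1 ⊗ₜ[ℂ] x) * (1 ⊗ₜ[ℂ] c i) := by simp
  have hx' : (1 : A) ⊗ₜ[ℂ] x * (δ i ⊗ₜ[ℂ] 1) = (δ i ⊗ₜ[ℂ] 1) * (1 ⊗ₜ[ℂ] x) := by simp
  rw [LinearMap.comp_apply, LinearMap.comp_apply, LinearMap.mulRight_apply,
    LinearMap.mulLeft_apply, ← sL_mul_left, mul_assoc, hcomm, ← mul_assoc,
    ← D.comul_mul_of_mem x hi, hS φ hφ, hS φ hφ, hx, mul_assoc, D.swap_right', ← mul_assoc, hx',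
    mul_assoc, sL_left_mul]

theorem lTensor_antipode_comul_mul (D : ComulData Δ B C b c β γ δ η) {S : A →ₗ[ℂ] A}
    (hS : ∀ φ : A →ₗ[ℂ] ℂ, (∀ x, sL φ (Δ x) ∈ C) → ∀ x y : A,
      S (sL φ (Δ x * (1 ⊗ₜ[ℂ] y))) = sL φ ((1 ⊗ₜ[ℂ] x) * Δ y)) (x y : A) :
    LinearMap.lTensor A S (Δ (x * y)) = twistedMul S (Δ x) (Δ y) := by
  obtain ⟨L, hL⟩ := D.exists_canonicalMap_lift
  have h1 : ∀ t, canonicalMap Δ (twistedMul S t (Δ y)) =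
      canonicalMap Δ (LinearMap.lTensor A S t) * (y ⊗ₜ[ℂ] 1) := by
    intro t
    induction t with
    | zero => simp
    | add u v hu hv => simp [add_mul, hu, hv]
    | tmul u v =>
      rw [twistedMul_tmul_left, canonicalMap_mul_right, D.canonicalMap_left_mul,
        D.canonicalMap_lTensor_antipode hS, ← mul_assoc, D.mul_idem]
      simp [mul_assoc]
  have h2 : ∀ t, middleMul β b (twistedMul S t (Δ y)) = twistedMul S t (Δ y) := by
    intro t
    induction t with
    | zero => simp
    | add u v hu hv => simp [hu, hv]
    | tmul u v => rw [twistedMul_tmul_left, middleMul_mul, D.middleMul_lTensor_antipode hS]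
  rw [← D.middleMul_lTensor_antipode hS, ← h2, ← hL, ← hL, h1, D.canonicalMap_lTensor_antipode hS,
    D.canonicalMap_lTensor_antipode hS, mul_assoc]
  simp

theorem counit_mul (D : ComulData Δ B C b c β γ δ η) {S : A →ₗ[ℂ] A}
    (hS : ∀ φ : A →ₗ[ℂ] ℂ, (∀ x, sL φ (Δ x) ∈ C) → ∀ x y : A,
      S (sL φ (Δ x * (1 ⊗ₜ[ℂ] y))) = sL φ ((1 ⊗ₜ[ℂ] x) * Δ y))
    {ε : A →ₗ[ℂ] ℂ} (hε : ∀ a, sR ε (Δ a) = a) (hε' : ∀ a, sL ε (Δ a) = a)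
    (hone : Δ 1 = ∑ i, b i ⊗ₜ[ℂ] c i) (hc : ∀ i, c i ∈ C) (x y : A) :
    ε (x * y) = ∑ i, ε (x * c i) * ε (b i * y) := by
  have h1 : ∀ z, ε (LinearMap.mul' ℂ A (LinearMap.lTensor A S (Δ z))) = ε z := by
    intro z
    rw [D.mul'_lTensor_antipode hS hε, ← apply_sL, sL_mul_left, ← hone, hε', one_mul]
  have h2 : LinearMap.mul' ℂ A (LinearMap.lTensor A S (Δ y)) = ∑ i, ε (b i * y) • c i := by
    rw [D.mul'_lTensor_antipode hS hε]
    simp [Finset.sum_mul]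
  have h3 : Δ x * ((∑ i, ε (b i * y) • c i) ⊗ₜ[ℂ] 1) = Δ (x * ∑ i, ε (b i * y) • c i) := by
    simp [TensorProduct.sum_tmul, ← TensorProduct.smul_tmul', Finset.mul_sum,
      D.comul_mul_of_mem x (hc _)]
  rw [← h1, D.lTensor_antipode_comul_mul hS, mul'_twistedMul, h2, h3, h1]
  simp [Finset.mul_sum, mul_comm]

theorem antipode_mul (D : ComulData Δ B C b c β γ δ η) {S : A →ₗ[ℂ] A}
    (hS : ∀ φ : A →ₗ[ℂ] ℂ, (∀ x, sL φ (Δ x) ∈ C) → ∀ x y : A,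
      S (sL φ (Δ x * (1 ⊗ₜ[ℂ] y))) = sL φ ((1 ⊗ₜ[ℂ] x) * Δ y))
    {ε : A →ₗ[ℂ] ℂ} (hε : ∀ a, sR ε (Δ a) = a) (hε' : ∀ a, sL ε (Δ a) = a)
    (hone : Δ 1 = ∑ i, b i ⊗ₜ[ℂ] c i) (hc : ∀ i, c i ∈ C) (hδ : ∑ i, b i * δ i = 1) (x y : A) :
    S (x * y) = S y * S x := by
  have hS1 : S 1 = 1 := by
    have h := D.mul'_lTensor_antipode hS hε 1
    rw [← Algebra.TensorProduct.one_def, mul_one, ← hone, hε, hone] at h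
    have hci : ∀ i, S (c i) = δ i * S 1 := fun i => by
      simpa using D.antipode_mul_of_mem hS 1 (hc i)
    simpa [hci, ← mul_assoc, ← Finset.sum_mul, hδ] using h
  have h1 : ∀ t u : A ⊗[ℂ] A, sR ε (twistedMul S t u) =
      ∑ i, S (sR ε ((b i ⊗ₜ[ℂ] 1) * u)) * S (sR ε (t * (c i ⊗ₜ[ℂ] 1))) := by
    intro t u
    induction t with
    | zero => simp
    | add v w hv hw => simp [add_mul, mul_add, Finset.sum_add_distrib, hv, hw]
    | tmul v w =>
      induction u with
      | zero => simp
      | add r s hr hs =>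
        simp only [mul_add, map_add, add_mul, Finset.sum_add_distrib, hr, hs]
      | tmul r s =>
        simp [D.counit_mul hS hε hε' hone hc v r, Finset.sum_smul, smul_smul]
  have h2 : ∀ x y, S (x * y) = (∑ i, S (γ i * y) * δ i) * S x := by
    intro x y
    rw [← hε (x * y), ← map_sR, D.lTensor_antipode_comul_mul hS, h1, Finset.sum_mul]
    refine Finset.sum_congr rfl fun i _ => ?_
    rw [D.swap_left, sR_right_mul, hε, ← D.comul_mul_of_mem x (hc i), hε,
      D.antipode_mul_of_mem hS x (hc i), mul_assoc]
  have h3 := h2 1 y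
  rw [one_mul, hS1, mul_one] at h3
  rw [h2, ← h3]

end ComulData

section SeparabilityIdempotent

variable {A : Type} [Ring A] [Algebra ℂ A]

theorem comul_one_eq {Δ : A →ₗ[ℂ] A ⊗[ℂ] A} (hΔ : ∀ a a' : A, Δ (a * a') = Δ a * Δ a')
    {E : A ⊗[ℂ] A} (hEΔ : ∀ a : A, E * Δ a = Δ a ∧ Δ a * E = Δ a)
    (hran : (Submodule.span ℂ {y : A ⊗[ℂ] A | ∃ a z, y = Δ a * z} : Set (A ⊗[ℂ] A)) =
      {y : A ⊗[ℂ] A | ∃ z, y = E * z}) : Δ 1 = E := by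
  have hE : E ∈ Submodule.span ℂ {y : A ⊗[ℂ] A | ∃ a z, y = Δ a * z} := by
    rw [← SetLike.mem_coe, hran]
    exact ⟨1, (mul_one E).symm⟩
  have hle : Submodule.span ℂ {y : A ⊗[ℂ] A | ∃ a z, y = Δ a * z} ≤
      LinearMap.eqLocus (LinearMap.mulLeft ℂ (Δ 1)) LinearMap.id := by
    rw [Submodule.span_le]
    rintro _ ⟨a, z, rfl⟩
    simp [← mul_assoc, ← hΔ]
  rw [← (hEΔ 1).2]
  exact hle hE

theorem sR_leg12 (ω : A →ₗ[ℂ] ℂ) (t : A ⊗[ℂ] A) : sR ω (leg12 A t) = sR ω t ⊗ₜ[ℂ] 1 := by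
  induction t with
  | zero => simp
  | add x y hx hy => simp [TensorProduct.add_tmul, hx, hy]
  | tmul x y => simp [leg12, TensorProduct.smul_tmul']

theorem sR_mul_one_tmul (ω : A →ₗ[ℂ] ℂ) (s : A ⊗[ℂ] (A ⊗[ℂ] A)) (u : A ⊗[ℂ] A) :
    sR ω (s * (1 ⊗ₜ[ℂ] u)) = sR ω s * u := by
  induction s with
  | zero => simp
  | add x y hx hy => simp [add_mul, hx, hy]
  | tmul x y => simp

theorem sR_one_tmul_mul (ω : A →ₗ[ℂ] ℂ) (s : A ⊗[ℂ] (A ⊗[ℂ] A)) (u : A ⊗[ℂ] A) :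
    sR ω ((1 ⊗ₜ[ℂ] u) * s) = u * sR ω s := by
  induction s with
  | zero => simp
  | add x y hx hy => simp [mul_add, hx, hy]
  | tmul x y => simp

theorem lTensor_sL_leg12_mul (ω : A →ₗ[ℂ] ℂ) (t u : A ⊗[ℂ] A) :
    LinearMap.lTensor A (sL ω) (leg12 A t * (1 ⊗ₜ[ℂ] u)) = t * (1 ⊗ₜ[ℂ] sL ω u) := by
  induction t with
  | zero => simp
  | add x y hx hy => simp [add_mul, hx, hy]
  | tmul x y => simp [leg12, sL_left_mul]

theorem lTensor_sL_mul_leg12 (ω : A →ₗ[ℂ] ℂ) (t u : A ⊗[ℂ] A) :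
    LinearMap.lTensor A (sL ω) ((1 ⊗ₜ[ℂ] u) * leg12 A t) = (1 ⊗ₜ[ℂ] sL ω u) * t := by
  induction t with
  | zero => simp
  | add x y hx hy => simp [mul_add, hx, hy]
  | tmul x y => simp [leg12, sL_mul_left]

theorem comul_sR_one {Δ : A →ₗ[ℂ] A ⊗[ℂ] A} {E : A ⊗[ℂ] A}
    (hE : LinearMap.lTensor A Δ E = leg12 A E * (1 ⊗ₜ[ℂ] E))
    (hE' : leg12 A E * (1 ⊗ₜ[ℂ] E) = (1 ⊗ₜ[ℂ] E) * leg12 A E) (ω : A →ₗ[ℂ] ℂ) :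
    Δ (sR ω E) = (sR ω E ⊗ₜ[ℂ] 1) * E ∧ Δ (sR ω E) = E * (sR ω E ⊗ₜ[ℂ] 1) := by
  rw [← sR_leg12, ← sR_mul_one_tmul, ← sR_one_tmul_mul, ← hE', ← map_sR, hE]
  exact ⟨rfl, rfl⟩

theorem comul_sL_one {Δ : A →ₗ[ℂ] A ⊗[ℂ] A} {E : A ⊗[ℂ] A}
    (hE : TensorProduct.assoc ℂ A A A (LinearMap.rTensor A Δ E) = leg12 A E * (1 ⊗ₜ[ℂ] E))
    (hE' : leg12 A E * (1 ⊗ₜ[ℂ] E) = (1 ⊗ₜ[ℂ] E) * leg12 A E) (ω : A →ₗ[ℂ] ℂ) :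
    Δ (sL ω E) = E * (1 ⊗ₜ[ℂ] sL ω E) ∧ Δ (sL ω E) = (1 ⊗ₜ[ℂ] sL ω E) * E := by
  rw [← lTensor_sL_leg12_mul, ← lTensor_sL_mul_leg12, ← hE', ← hE, lTensor_sL_assoc_rTensor]
  exact ⟨rfl, rfl⟩

theorem sL_map_val {B C : Subalgebra ℂ A} (ω : C →ₗ[ℂ] ℂ) (ω' : A →ₗ[ℂ] ℂ)
    (h : ω' ∘ₗ C.val.toLinearMap = ω) (t : B ⊗[ℂ] C) :
    sL ω' (TensorProduct.map B.val.toLinearMap C.val.toLinearMap t) = sL ω t := by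
  subst h
  induction t with
  | zero => simp
  | add x y hx hy => simp [hx, hy]
  | tmul x y => simp

theorem sR_map_val {B C : Subalgebra ℂ A} (ω : B →ₗ[ℂ] ℂ) (ω' : A →ₗ[ℂ] ℂ)
    (h : ω' ∘ₗ B.val.toLinearMap = ω) (t : B ⊗[ℂ] C) :
    sR ω' (TensorProduct.map B.val.toLinearMap C.val.toLinearMap t) = sR ω t := by
  subst h
  induction t with
  | zero => simp
  | add x y hx hy => simp [hx, hy]
  | tmul x y => simp

theorem exists_sL_eq {B C : Subalgebra ℂ A} {E' : B ⊗[ℂ] C}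
    (h : Submodule.span ℂ {x : B | ∃ ω : C →ₗ[ℂ] ℂ, x = sL ω E'} = ⊤) (k : B) :
    ∃ ω : A →ₗ[ℂ] ℂ,
      sL ω (TensorProduct.map B.val.toLinearMap C.val.toLinearMap E') = k := by
  have hk : k ∈ Submodule.span ℂ {x : B | ∃ ω : C →ₗ[ℂ] ℂ, x = sL ω E'} := h ▸ trivial
  induction hk using Submodule.span_induction with
  | mem x hx =>
    obtain ⟨ω, rfl⟩ := hx
    obtain ⟨ω', hω'⟩ := LinearMap.exists_extend (p := C.toSubmodule) ω
    exact ⟨ω', sL_map_val ω ω' hω' E'⟩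
  | zero => exact ⟨0, by simp [sL]⟩
  | add x y _ _ hx hy =>
    obtain ⟨ω, hω⟩ := hx
    obtain ⟨ω', hω'⟩ := hy
    exact ⟨ω + ω', by simp [← hω, ← hω', sL, LinearMap.lTensor_add]⟩
  | smul r x _ hx =>
    obtain ⟨ω, hω⟩ := hx
    exact ⟨r • ω, by simp [← hω, sL, LinearMap.lTensor_smul]⟩

theorem exists_sR_eq {B C : Subalgebra ℂ A} {E' : B ⊗[ℂ] C}
    (h : Submodule.span ℂ {x : C | ∃ ω : B →ₗ[ℂ] ℂ, x = sR ω E'} = ⊤) (k : C) :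
    ∃ ω : A →ₗ[ℂ] ℂ,
      sR ω (TensorProduct.map B.val.toLinearMap C.val.toLinearMap E') = k := by
  have hk : k ∈ Submodule.span ℂ {x : C | ∃ ω : B →ₗ[ℂ] ℂ, x = sR ω E'} := h ▸ trivial
  induction hk using Submodule.span_induction with
  | mem x hx =>
    obtain ⟨ω, rfl⟩ := hx
    obtain ⟨ω', hω'⟩ := LinearMap.exists_extend (p := B.toSubmodule) ω
    exact ⟨ω', sR_map_val ω ω' hω' E'⟩
  | zero => exact ⟨0, by simp [sR]⟩
  | add x y _ _ hx hy =>
    obtain ⟨ω, hω⟩ := hx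
    obtain ⟨ω', hω'⟩ := hy
    exact ⟨ω + ω', by simp [← hω, ← hω', sR, LinearMap.rTensor_add]⟩
  | smul r x _ hx =>
    obtain ⟨ω, hω⟩ := hx
    exact ⟨r • ω, by simp [← hω, sR, LinearMap.rTensor_smul]⟩

theorem map_val_mul {B C : Subalgebra ℂ A} (s t : B ⊗[ℂ] C) :
    TensorProduct.map B.val.toLinearMap C.val.toLinearMap (s * t) =
      TensorProduct.map B.val.toLinearMap C.val.toLinearMap s *
        TensorProduct.map B.val.toLinearMap C.val.toLinearMap t :=
  map_mul (Algebra.TensorProduct.map B.val C.val) s t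

end SeparabilityIdempotent

theorem statement18
    (A : Type) [Ring A] [Algebra ℂ A]
    (Δ : A →ₗ[ℂ] A ⊗[ℂ] A)
    (hΔmul : ∀ a a' : A, Δ (a * a') = Δ a * Δ a')
    (hΔcoassoc : ∀ a : A,
      TensorProduct.assoc ℂ A A A (LinearMap.rTensor A Δ (Δ a)) = LinearMap.lTensor A Δ (Δ a))
    (hΔfullL : Submodule.span ℂ {x : A | ∃ ω : A →ₗ[ℂ] ℂ, ∃ a : A, x = sL ω (Δ a)} = ⊤)
    (hΔfullR : Submodule.span ℂ {x : A | ∃ ω : A →ₗ[ℂ] ℂ, ∃ a : A, x = sR ω (Δ a)} = ⊤)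
    (E : A ⊗[ℂ] A)
    (hEE : E * E = E)
    (hEΔ : ∀ a : A, E * Δ a = Δ a ∧ Δ a * E = Δ a)
    (hranL : (Submodule.span ℂ {y : A ⊗[ℂ] A | ∃ a z, y = Δ a * z} : Set (A ⊗[ℂ] A)) =
      {y : A ⊗[ℂ] A | ∃ z, y = E * z})
    (hranR : (Submodule.span ℂ {y : A ⊗[ℂ] A | ∃ a z, y = z * Δ a} : Set (A ⊗[ℂ] A)) =
      {y : A ⊗[ℂ] A | ∃ z, y = z * E})
    (hΔE1 : TensorProduct.assoc ℂ A A A (LinearMap.rTensor A Δ E) =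
      leg12 A E * ((1 : A) ⊗ₜ[ℂ] E))
    (hΔE2 : leg12 A E * ((1 : A) ⊗ₜ[ℂ] E) = ((1 : A) ⊗ₜ[ℂ] E) * leg12 A E)
    (B C : Subalgebra ℂ A)
    (E' : ↥B ⊗[ℂ] ↥C)
    (hE'E : TensorProduct.map B.val.toLinearMap C.val.toLinearMap E' = E)
    (hE'full1 : Submodule.span ℂ {x : ↥B | ∃ ω : ↥C →ₗ[ℂ] ℂ, x = sL ω E'} = ⊤)
    (hE'full2 : Submodule.span ℂ {y : ↥C | ∃ ω : ↥B →ₗ[ℂ] ℂ, y = sR ω E'} = ⊤)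
    (SB : ↥B ≃ₗ[ℂ] ↥C) (SC : ↥C ≃ₗ[ℂ] ↥B)
    (hSBanti : ∀ b b' : ↥B, SB (b * b') = SB b' * SB b)
    (hSCanti : ∀ c c' : ↥C, SC (c * c') = SC c' * SC c)
    (hSBrel : ∀ b : ↥B, E' * (b ⊗ₜ[ℂ] (1 : ↥C)) = E' * ((1 : ↥B) ⊗ₜ[ℂ] SB b))
    (hSCrel : ∀ c : ↥C, ((1 : ↥B) ⊗ₜ[ℂ] c) * E' = (SC c ⊗ₜ[ℂ] (1 : ↥C)) * E')
    (hfaithL : FaithfulLeftIntegrals A Δ C)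
    (hfaithR : FaithfulRightIntegrals A Δ B) :
    ∃ (ε : A →ₗ[ℂ] ℂ) (S : A →ₗ[ℂ] A),
      (∀ a b : A, sR ε (Δ a * ((1 : A) ⊗ₜ[ℂ] b)) = a * b ∧
        sL ε ((a ⊗ₜ[ℂ] (1 : A)) * Δ b) = a * b) ∧
      Function.Bijective S ∧
      (∀ a a' : A, S (a * a') = S a' * S a) ∧
      (∀ a : A, LinearMap.mul' ℂ A (TensorProduct.map S LinearMap.id (Δ a)) =
        sL ε (((1 : A) ⊗ₜ[ℂ] a) * E)) ∧
      (∀ a : A, LinearMap.mul' ℂ A (TensorProduct.map LinearMap.id S (Δ a)) =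
        sR ε (E * (a ⊗ₜ[ℂ] (1 : A)))) ∧
      (∀ φ : A →ₗ[ℂ] ℂ, IsLeftIntegral A Δ C φ → ∀ a b : A,
        S (sL φ (Δ a * ((1 : A) ⊗ₜ[ℂ] b))) = sL φ (((1 : A) ⊗ₜ[ℂ] a) * Δ b)) := by
  have hone : Δ 1 = E := comul_one_eq hΔmul hEΔ hranL
  have hEcoassoc : LinearMap.lTensor A Δ E = leg12 A E * ((1 : A) ⊗ₜ[ℂ] E) := by
    rw [← hΔE1, ← hone, hΔcoassoc]
  have hB : ∀ k ∈ (B : Set A), ∃ ω : A →ₗ[ℂ] ℂ, sL ω E = k := fun k hk => by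
    simpa [hE'E] using exists_sL_eq hE'full1 ⟨k, hk⟩
  have hC : ∀ k ∈ (C : Set A), ∃ ω : A →ₗ[ℂ] ℂ, sR ω E = k := fun k hk => by
    simpa [hE'E] using exists_sR_eq hE'full2 ⟨k, hk⟩
  have hSBE : ∀ b : B, E * ((b : A) ⊗ₜ[ℂ] 1) = E * ((1 : A) ⊗ₜ[ℂ] (SB b : A)) := fun b => by
    have h := congrArg (TensorProduct.map B.val.toLinearMap C.val.toLinearMap) (hSBrel b)
    rw [map_val_mul, map_val_mul, hE'E] at h
    simpa using h
  have hSCE : ∀ c : C, ((1 : A) ⊗ₜ[ℂ] (c : A)) * E = ((SC c : A) ⊗ₜ[ℂ] 1) * E := fun c => by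
    have h := congrArg (TensorProduct.map B.val.toLinearMap C.val.toLinearMap) (hSCrel c)
    rw [map_val_mul, map_val_mul, hE'E] at h
    simpa using h
  have hleft : ∀ {t u : A ⊗[ℂ] A}, t * E = u * E → ∀ a, t * Δ a = u * Δ a := fun h a => by
    rw [← (hEΔ a).1, ← mul_assoc, h, mul_assoc]
  have hright : ∀ {t u : A ⊗[ℂ] A}, E * t = E * u → ∀ a, Δ a * t = Δ a * u := fun h a => by
    rw [← (hEΔ a).2, mul_assoc, h, mul_assoc]
  have hSC1 : SC 1 = 1 := by
    obtain ⟨k, hk⟩ := SC.surjective 1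
    exact Eq.symm (by simpa [hk] using hSCanti k 1)
  obtain ⟨s, hs⟩ := TensorProduct.exists_finset E'
  let b : s → A := fun i => i.1.1
  let c : s → A := fun i => i.1.2
  have hEsum : E = ∑ i, b i ⊗ₜ[ℂ] c i := by
    rw [← hE'E, hs, map_sum, ← Finset.sum_coe_sort]
    rfl
  have D : ComulData Δ (B : Set A) (C : Set A) b c (fun i => (SB.symm i.1.2 : A))
      (fun i => (SC.symm i.1.1 : A)) (fun i => (SC i.1.2 : A)) (fun i => (SB i.1.1 : A)) :=
    { comul_mul := hΔmul
      coassoc := hΔcoassoc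
      full_left := hΔfullL
      full_right := hΔfullR
      idem_mul := fun a => hEsum ▸ (hEΔ a).1
      mul_idem := fun a => hEsum ▸ (hEΔ a).2
      comul_left := fun k hk => by
        obtain ⟨ω, rfl⟩ := hC k hk
        rw [← hEsum]
        exact (comul_sR_one hEcoassoc hΔE2 ω).2
      comul_left' := fun k hk => by
        obtain ⟨ω, rfl⟩ := hC k hk
        rw [← hEsum]
        exact (comul_sR_one hEcoassoc hΔE2 ω).1
      comul_right := fun k hk => by
        obtain ⟨ω, rfl⟩ := hB k hk
        rw [← hEsum]
        exact (comul_sL_one hΔE1 hΔE2 ω).2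
      comul_right' := fun k hk => by
        obtain ⟨ω, rfl⟩ := hB k hk
        rw [← hEsum]
        exact (comul_sL_one hΔE1 hΔE2 ω).1
      swap_left := fun i => hleft (by simpa using (hSCE (SC.symm i.1.1)).symm)
      swap_left' := fun i => hright (hSBE i.1.1)
      swap_right := fun i => hright (by simpa using (hSBE (SB.symm i.1.2)).symm)
      swap_right' := fun i => hleft (hSCE i.1.2)
      left_faithful := fun a h => hfaithL.1 a fun φ hφ => h φ hφ.2
      left_faithful' := fun a h => hfaithL.2 a fun φ hφ => h φ hφ.2
      right_faithful := fun a h => hfaithR.2 a fun ψ hψ => h ψ hψ.2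
      right_faithful' := fun a h => hfaithR.1 a fun ψ hψ => h ψ hψ.2 }
  obtain ⟨e, he⟩ := hB 1 B.one_mem
  have heγ : ∑ i : s, e (c i) • (SC.symm i.1.1 : A) = 1 := by
    have h : ∑ i : s, e (c i) • i.1.1 = 1 := by
      apply Subtype.ext
      simpa [hEsum, b, c] using he
    have h' : ∑ i : s, e (c i) • SC.symm i.1.1 = 1 := by
      simp_rw [← map_smul, ← map_sum, h]
      rw [← hSC1, LinearEquiv.symm_apply_apply]
    simpa using congrArg Subtype.val h'
  have hδ : ∑ i : s, b i * (SC i.1.2 : A) = 1 := by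
    have h : E = ((∑ i : s, b i * (SC i.1.2 : A)) ⊗ₜ[ℂ] 1) * E := by
      conv_lhs => rw [← hEE]
      conv_lhs =>
        enter [1]
        rw [hEsum]
      rw [Finset.sum_mul, TensorProduct.sum_tmul, Finset.sum_mul]
      refine Finset.sum_congr rfl fun i _ => ?_
      have hi : b i ⊗ₜ[ℂ] c i = (b i ⊗ₜ[ℂ] 1) * ((1 : A) ⊗ₜ[ℂ] c i) := by simp
      rw [hi, mul_assoc, hSCE, ← mul_assoc]
      simp
    have h' := congrArg (sL e) h
    rwa [sL_left_mul, he, mul_one, eq_comm] at h'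
  obtain ⟨ε, hε, hε'⟩ := D.exists_counit heγ
  obtain ⟨S, hS⟩ := D.exists_antipode hε
  refine ⟨ε, S, fun x y => ⟨by rw [sR_mul_right, hε], by rw [sL_left_mul, hε']⟩,
    D.bijective_antipode hε hS,
    D.antipode_mul hS hε hε' (hone.trans hEsum) (fun i => i.1.2.2) hδ,
    fun x => ?_, fun x => ?_, fun φ hφ => hS φ hφ.2⟩
  · rw [hEsum, ← D.mul'_rTensor_antipode hS hε hε']
    rfl
  · rw [hEsum, ← D.mul'_lTensor_antipode hS hε]
    rfl
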